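/- Let v be a unit vector in H₃ whose minimal local eigenvalues lie on the boundary of the Kirwan polytope, i.e., p_i(v) = 1/2 for some i ∈ {1,2,3}, or p_i(v) = p_j(v) + p_k(v) for some permutation (i,j,k) of (1,2,3). Then every unit vector w ∈ H₃ with p_i(w) = p_i(v) for i = 1,2,3 is LU-equivalent to v. In other words, such a state is uniquely determined, up to local unitaries, by the spectra of its one-qubit reduced density matrices. -/

import Mathlib

open scoped BigOperators

/-- The three-qubit Hilbert space. -/
abbrev H3 := (Fin 2 × Fin 2 × Fin 2) → ℂ

/-- Squared Hermitian norm of a vector in `H3`. -/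
noncomputable def normSq3 (v : H3) : ℝ := ∑ x : Fin 2 × Fin 2 × Fin 2, Complex.normSq (v x)

/-- First one-qubit reduced density matrix. -/
noncomputable def rho1 (v : H3) : Matrix (Fin 2) (Fin 2) ℂ :=
  Matrix.of fun a a' => ∑ b : Fin 2, ∑ c : Fin 2, v (a, b, c) * star (v (a', b, c))

/-- Second one-qubit reduced density matrix. -/
noncomputable def rho2 (v : H3) : Matrix (Fin 2) (Fin 2) ℂ :=
  Matrix.of fun b b' => ∑ a : Fin 2, ∑ c : Fin 2, v (a, b, c) * star (v (a, b', c))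

/-- Third one-qubit reduced density matrix. -/
noncomputable def rho3 (v : H3) : Matrix (Fin 2) (Fin 2) ℂ :=
  Matrix.of fun c c' => ∑ a : Fin 2, ∑ b : Fin 2, v (a, b, c) * star (v (a, b, c'))

/-- Minimal (real) eigenvalue of a 2×2 complex matrix. -/
noncomputable def minEig (ρ : Matrix (Fin 2) (Fin 2) ℂ) : ℝ :=
  sInf {t : ℝ | (t : ℂ) ∈ spectrum ℂ ρ}

noncomputable def p1 (v : H3) : ℝ := minEig (rho1 v)
noncomputable def p2 (v : H3) : ℝ := minEig (rho2 v)
noncomputable def p3 (v : H3) : ℝ := minEig (rho3 v)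

/-- The action of a triple of 2×2 matrices on `H3` by the tensor product. -/
noncomputable def tensor3 (A1 A2 A3 : Matrix (Fin 2) (Fin 2) ℂ) (v : H3) : H3 :=
  fun x => ∑ a' : Fin 2, ∑ b' : Fin 2, ∑ c' : Fin 2,
    A1 x.1 a' * A2 x.2.1 b' * A3 x.2.2 c' * v (a', b', c')

/-- Local unitary equivalence of three-qubit states. -/
def LUequiv (v w : H3) : Prop :=
  ∃ U1 U2 U3 : Matrix (Fin 2) (Fin 2) ℂ,
    U1 ∈ Matrix.unitaryGroup (Fin 2) ℂ ∧ U2 ∈ Matrix.unitaryGroup (Fin 2) ℂ ∧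
    U3 ∈ Matrix.unitaryGroup (Fin 2) ℂ ∧ w = tensor3 U1 U2 U3 v

/-- The three-qubit W state. -/
noncomputable def wState : H3 := fun x =>
  if (x.1 = 1 ∧ x.2.1 = 0 ∧ x.2.2 = 0) ∨ (x.1 = 0 ∧ x.2.1 = 1 ∧ x.2.2 = 0) ∨
      (x.1 = 0 ∧ x.2.1 = 0 ∧ x.2.2 = 1)
  then ((1 / Real.sqrt 3 : ℝ) : ℂ) else 0

/-- The SLOCC class of the W state. -/
def WClass : Set H3 :=
  {v | ∃ (A1 A2 A3 : Matrix (Fin 2) (Fin 2) ℂ) (l : ℂ),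
    A1.det = 1 ∧ A2.det = 1 ∧ A3.det = 1 ∧ l ≠ 0 ∧ v = l • tensor3 A1 A2 A3 wState}

open Matrix

abbrev M2 := Matrix (Fin 2) (Fin 2) ℂ

theorem tensor3_comp (A1 A2 A3 B1 B2 B3 : M2) (v : H3) :
    tensor3 A1 A2 A3 (tensor3 B1 B2 B3 v) = tensor3 (A1 * B1) (A2 * B2) (A3 * B3) v := by
  funext x
  simp only [tensor3, Matrix.mul_apply, Fin.sum_univ_two]
  ring

theorem tensor3_one (v : H3) : tensor3 1 1 1 v = v := by
  funext x
  revert x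
  simp [Prod.forall, Fin.forall_fin_two, tensor3]

theorem LU_trans {u v w : H3} (h : LUequiv u v) (h' : LUequiv v w) : LUequiv u w := by
  obtain ⟨A, B, C, hA, hB, hC, rfl⟩ := h
  obtain ⟨A', B', C', hA', hB', hC', rfl⟩ := h'
  exact ⟨A' * A, B' * B, C' * C, mul_mem hA' hA, mul_mem hB' hB, mul_mem hC' hC,
    tensor3_comp _ _ _ _ _ _ _⟩

theorem LU_symm {v w : H3} (h : LUequiv v w) : LUequiv w v := by
  obtain ⟨A, B, C, hA, hB, hC, rfl⟩ := h
  refine ⟨star A, star B, star C, Unitary.star_mem hA, Unitary.star_mem hB,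
    Unitary.star_mem hC, ?_⟩
  rw [tensor3_comp, (Matrix.mem_unitaryGroup_iff'.1 hA), (Matrix.mem_unitaryGroup_iff'.1 hB),
    (Matrix.mem_unitaryGroup_iff'.1 hC), tensor3_one]

def sw12 (v : H3) : H3 := fun x => v (x.2.1, x.1, x.2.2)
def sw13 (v : H3) : H3 := fun x => v (x.2.2, x.2.1, x.1)

theorem sw12_tensor (A B C : M2) (v : H3) :
    sw12 (tensor3 A B C v) = tensor3 B A C (sw12 v) := by
  funext x
  simp only [tensor3, sw12, Fin.sum_univ_two]
  ring

theorem sw13_tensor (A B C : M2) (v : H3) :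
    sw13 (tensor3 A B C v) = tensor3 C B A (sw13 v) := by
  funext x
  simp only [tensor3, sw13, Fin.sum_univ_two]
  ring

theorem sw12_sw12 (v : H3) : sw12 (sw12 v) = v := rfl
theorem sw13_sw13 (v : H3) : sw13 (sw13 v) = v := rfl

theorem LU_sw12 {v w : H3} (h : LUequiv (sw12 v) (sw12 w)) : LUequiv v w := by
  obtain ⟨A, B, C, hA, hB, hC, h⟩ := h
  refine ⟨B, A, C, hB, hA, hC, ?_⟩
  have := congrArg sw12 h
  rwa [sw12_tensor, sw12_sw12, sw12_sw12] at this

theorem LU_sw13 {v w : H3} (h : LUequiv (sw13 v) (sw13 w)) : LUequiv v w := by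
  obtain ⟨A, B, C, hA, hB, hC, h⟩ := h
  refine ⟨C, B, A, hC, hB, hA, ?_⟩
  have := congrArg sw13 h
  rwa [sw13_tensor, sw13_sw13, sw13_sw13] at this

theorem rho1_sw12 (v : H3) : rho1 (sw12 v) = rho2 v := rfl
theorem rho2_sw12 (v : H3) : rho2 (sw12 v) = rho1 v := rfl
theorem rho3_sw12 (v : H3) : rho3 (sw12 v) = rho3 v := by
  ext i j; simp only [rho3, sw12, Fin.sum_univ_two, Matrix.of_apply]; ring
theorem rho1_sw13 (v : H3) : rho1 (sw13 v) = rho3 v := by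
  ext i j; simp only [rho1, rho3, sw13, Fin.sum_univ_two, Matrix.of_apply]; ring
theorem rho2_sw13 (v : H3) : rho2 (sw13 v) = rho2 v := by
  ext i j; simp only [rho2, sw13, Fin.sum_univ_two, Matrix.of_apply]; ring
theorem rho3_sw13 (v : H3) : rho3 (sw13 v) = rho1 v := by
  ext i j; simp only [rho1, rho3, sw13, Fin.sum_univ_two, Matrix.of_apply]; ring

theorem normSq3_sw12 (v : H3) : normSq3 (sw12 v) = normSq3 v := by
  simp only [normSq3, sw12, Fintype.sum_prod_type, Fin.sum_univ_two]; ring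
theorem normSq3_sw13 (v : H3) : normSq3 (sw13 v) = normSq3 v := by
  simp only [normSq3, sw13, Fintype.sum_prod_type, Fin.sum_univ_two]; ring

def flat (v : H3) : Matrix (Fin 2) (Fin 2 × Fin 2) ℂ := Matrix.of fun a x => v (a, x)

theorem rho1_flat (v : H3) : rho1 v = flat v * (flat v)ᴴ := by
  ext i j
  simp [rho1, flat, Matrix.mul_apply, Fintype.sum_prod_type]

open scoped Kronecker in
theorem flat_tensor (A B C : M2) (v : H3) :
    flat (tensor3 A B C v) = A * flat v * (B ⊗ₖ C)ᵀ := by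
  ext i ⟨j, k⟩
  simp only [flat, tensor3, Matrix.mul_apply, Fintype.sum_prod_type, Fin.sum_univ_two,
    Matrix.of_apply, Matrix.transpose_apply, Matrix.kroneckerMap_apply]
  ring

open scoped Kronecker in
theorem rho1_tensor {A B C : M2} (hB : B ∈ Matrix.unitaryGroup (Fin 2) ℂ)
    (hC : C ∈ Matrix.unitaryGroup (Fin 2) ℂ) (v : H3) :
    rho1 (tensor3 A B C v) = A * rho1 v * Aᴴ := by
  have hK : (B ⊗ₖ C)ᵀ * ((B ⊗ₖ C)ᵀ)ᴴ = 1 := by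
    have h : (B ⊗ₖ C)ᴴ * (B ⊗ₖ C) = 1 := by
      rw [Matrix.conjTranspose_kronecker, ← Matrix.mul_kronecker_mul]
      have h1 := Matrix.mem_unitaryGroup_iff'.1 hB
      have h2 := Matrix.mem_unitaryGroup_iff'.1 hC
      rw [Matrix.star_eq_conjTranspose] at h1 h2
      rw [h1, h2, Matrix.one_kronecker_one]
    have := congrArg Matrix.transpose h
    rwa [Matrix.transpose_mul, Matrix.transpose_one] at this
  rw [rho1_flat, rho1_flat, flat_tensor, Matrix.conjTranspose_mul, Matrix.conjTranspose_mul]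
  calc _ = A * flat v * ((B ⊗ₖ C)ᵀ * ((B ⊗ₖ C)ᵀ)ᴴ) * ((flat v)ᴴ * Aᴴ) := by
        simp only [Matrix.mul_assoc]
    _ = _ := by rw [hK]; simp only [Matrix.mul_assoc, Matrix.one_mul]

theorem rho2_tensor {A B C : M2} (hA : A ∈ Matrix.unitaryGroup (Fin 2) ℂ)
    (hC : C ∈ Matrix.unitaryGroup (Fin 2) ℂ) (v : H3) :
    rho2 (tensor3 A B C v) = B * rho2 v * Bᴴ := by
  rw [← rho1_sw12, ← rho1_sw12, sw12_tensor, rho1_tensor hA hC]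

theorem rho3_tensor {A B C : M2} (hA : A ∈ Matrix.unitaryGroup (Fin 2) ℂ)
    (hB : B ∈ Matrix.unitaryGroup (Fin 2) ℂ) (v : H3) :
    rho3 (tensor3 A B C v) = C * rho3 v * Cᴴ := by
  rw [← rho1_sw13, ← rho1_sw13, sw13_tensor, rho1_tensor hB hA]

theorem norm_trace (v : H3) : (normSq3 v : ℂ) = (rho1 v).trace := by
  simp only [normSq3, Fintype.sum_prod_type, Fin.sum_univ_two, rho1, Matrix.trace,
    Matrix.diag, Matrix.of_apply]
  push_cast
  simp only [Complex.normSq_eq_conj_mul_self, Complex.star_def]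
  ring

theorem unit_conj_trace {U : M2} (hU : U ∈ Matrix.unitaryGroup (Fin 2) ℂ) (M : M2) :
    (U * M * Uᴴ).trace = M.trace := by
  have h := Matrix.mem_unitaryGroup_iff'.1 hU
  rw [Matrix.star_eq_conjTranspose] at h
  rw [Matrix.trace_mul_comm, ← Matrix.mul_assoc, h, Matrix.one_mul]

theorem unit_conj_det {U : M2} (hU : U ∈ Matrix.unitaryGroup (Fin 2) ℂ) (M : M2) :
    (U * M * Uᴴ).det = M.det := by
  have h := Matrix.mem_unitaryGroup_iff'.1 hU
  rw [Matrix.star_eq_conjTranspose] at h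
  rw [Matrix.det_mul_comm, ← Matrix.mul_assoc, h, Matrix.one_mul]

/-- All data preserved by LU. -/
theorem LU_inv {v w : H3} (h : LUequiv v w) : normSq3 w = normSq3 v ∧
    (rho1 w).det = (rho1 v).det ∧ (rho2 w).det = (rho2 v).det ∧ (rho3 w).det = (rho3 v).det := by
  obtain ⟨A, B, C, hA, hB, hC, rfl⟩ := h
  refine ⟨?_, ?_, ?_, ?_⟩
  · have : ((normSq3 (tensor3 A B C v) : ℝ) : ℂ) = (normSq3 v : ℝ) := by
      rw [norm_trace, norm_trace, rho1_tensor hB hC, unit_conj_trace hA]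
    exact_mod_cast this
  · rw [rho1_tensor hB hC, unit_conj_det hA]
  · rw [rho2_tensor hA hC, unit_conj_det hB]
  · rw [rho3_tensor hA hB, unit_conj_det hC]

theorem herm1 (v : H3) : (rho1 v).IsHermitian := by
  rw [rho1_flat]; exact Matrix.isHermitian_mul_conjTranspose_self _

/-- Hermitian, trace one 2×2 : determinant in terms of minimal eigenvalue. -/
theorem minEig_det {M : M2} (hM : M.IsHermitian) (ht : M.trace = 1) :
    minEig M ≤ 1 / 2 ∧ M.det = ((minEig M * (1 - minEig M) : ℝ) : ℂ) := by
  have h00 : (starRingEnd ℂ) (M 0 0) = M 0 0 := hM.apply 0 0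
  have h10 : (starRingEnd ℂ) (M 1 0) = M 0 1 := hM.apply 0 1
  obtain ⟨x, hx⟩ := Complex.conj_eq_iff_real.1 h00
  have h11 : M 1 1 = ((1 - x : ℝ) : ℂ) := by
    rw [Matrix.trace_fin_two, hx] at ht
    push_cast
    linear_combination ht
  set n := Complex.normSq (M 1 0) with hn
  have hn0 : 0 ≤ n := Complex.normSq_nonneg _
  have hnc : M 0 1 * M 1 0 = (n : ℂ) := by
    rw [← h10, hn, Complex.normSq_eq_conj_mul_self]
  set D : ℝ := x * (1 - x) - n with hD
  have hdet : M.det = (D : ℂ) := by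
    rw [Matrix.det_fin_two, hnc, hx, h11, hD]; push_cast; ring
  have hdisc : 0 ≤ 1 - 4 * D := by rw [hD]; nlinarith [sq_nonneg (2 * x - 1)]
  set r := Real.sqrt (1 - 4 * D) with hr
  have hr0 : 0 ≤ r := Real.sqrt_nonneg _
  have hr2 : r * r = 1 - 4 * D := Real.mul_self_sqrt hdisc
  have hspec : ∀ t : ℝ, (t : ℂ) ∈ spectrum ℂ M ↔ (t - (1 - r) / 2) * (t - (1 + r) / 2) = 0 := by
    intro t
    rw [spectrum.mem_iff, Matrix.isUnit_iff_isUnit_det, isUnit_iff_ne_zero, not_not]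
    have : ((algebraMap ℂ M2) (t : ℂ) - M).det =
        (((t - (1 - r) / 2) * (t - (1 + r) / 2) : ℝ) : ℂ) := by
      rw [Matrix.det_fin_two]
      simp only [Matrix.algebraMap_matrix_apply, Matrix.sub_apply]
      have : (D : ℂ) = x * (1 - x) - n := by rw [hD]; push_cast; ring
      have h2 : (r : ℂ) * r = 1 - 4 * D := by exact_mod_cast hr2
      simp [hx, h11]
      linear_combination (-1 : ℂ) * hnc - (1 / 4 : ℂ) * h2 * (-1) - this
    rw [this]
    norm_cast
  have hset : {t : ℝ | (t : ℂ) ∈ spectrum ℂ M} = {(1 - r) / 2, (1 + r) / 2} := by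
    ext t
    simp only [Set.mem_ofPred_eq, hspec, mul_eq_zero, sub_eq_zero, Set.mem_insert_iff,
      Set.mem_singleton_iff]
  have hmin : minEig M = (1 - r) / 2 := by
    rw [minEig, hset, csInf_pair]
    exact inf_eq_left.2 (by linarith)
  rw [hmin, hdet]
  refine ⟨by linarith, ?_⟩
  congr 1
  linarith [hr2]

theorem trace1 {v : H3} (hv : normSq3 v = 1) : (rho1 v).trace = 1 := by
  rw [← norm_trace, hv]; norm_num
theorem trace2 {v : H3} (hv : normSq3 v = 1) : (rho2 v).trace = 1 := by
  rw [← rho1_sw12]; exact trace1 (by rw [normSq3_sw12, hv])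
theorem trace3 {v : H3} (hv : normSq3 v = 1) : (rho3 v).trace = 1 := by
  rw [← rho1_sw13]; exact trace1 (by rw [normSq3_sw13, hv])
theorem herm2 (v : H3) : (rho2 v).IsHermitian := by
  rw [← rho1_sw12]; exact herm1 _
theorem herm3 (v : H3) : (rho3 v).IsHermitian := by
  rw [← rho1_sw13]; exact herm1 _

theorem act1 (U : M2) (v : H3) (a b c : Fin 2) :
    tensor3 U 1 1 v (a, b, c) = U a 0 * v (0, b, c) + U a 1 * v (1, b, c) := by
  revert b c
  simp [Fin.forall_fin_two, tensor3]
theorem act2 (U : M2) (v : H3) (a b c : Fin 2) :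
    tensor3 1 U 1 v (a, b, c) = U b 0 * v (a, 0, c) + U b 1 * v (a, 1, c) := by
  revert a c
  simp [Fin.forall_fin_two, tensor3]
theorem act3 (U : M2) (v : H3) (a b c : Fin 2) :
    tensor3 1 1 U v (a, b, c) = U c 0 * v (a, b, 0) + U c 1 * v (a, b, 1) := by
  revert a b
  simp [Fin.forall_fin_two, tensor3]

theorem LU1 {U : M2} (hU : U ∈ Matrix.unitaryGroup (Fin 2) ℂ) (v : H3) :
    LUequiv v (tensor3 U 1 1 v) := ⟨U, 1, 1, hU, one_mem _, one_mem _, rfl⟩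
theorem LU2 {U : M2} (hU : U ∈ Matrix.unitaryGroup (Fin 2) ℂ) (v : H3) :
    LUequiv v (tensor3 1 U 1 v) := ⟨1, U, 1, one_mem _, hU, one_mem _, rfl⟩
theorem LU3 {U : M2} (hU : U ∈ Matrix.unitaryGroup (Fin 2) ℂ) (v : H3) :
    LUequiv v (tensor3 1 1 U v) := ⟨1, 1, U, one_mem _, one_mem _, hU, rfl⟩

theorem exists_scale (s t : ℂ) (h : ¬ (s = 0 ∧ t = 0)) :
    ∃ k : ℝ, (k : ℂ) * k * (s * star s + t * star t) = 1 := by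
  have hpos : 0 < Complex.normSq s + Complex.normSq t := by
    by_contra hc
    have h1 := Complex.normSq_nonneg s
    have h2 := Complex.normSq_nonneg t
    exact h ⟨Complex.normSq_eq_zero.1 (by linarith), Complex.normSq_eq_zero.1 (by linarith)⟩
  refine ⟨(Real.sqrt (Complex.normSq s + Complex.normSq t))⁻¹, ?_⟩
  have h2 : s * star s + t * star t = ((Complex.normSq s + Complex.normSq t : ℝ) : ℂ) := by
    push_cast
    simp only [Complex.normSq_eq_conj_mul_self, Complex.star_def]
    ring
  rw [h2]
  norm_cast
  rw [← mul_inv, Real.mul_self_sqrt hpos.le]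
  exact inv_mul_cancel₀ hpos.ne'

theorem row0 (s t : ℂ) (h : ¬ (s = 0 ∧ t = 0)) :
    ∃ U ∈ Matrix.unitaryGroup (Fin 2) ℂ, ∃ k : ℂ, U 0 0 = k * s ∧ U 0 1 = k * t := by
  obtain ⟨k, hk⟩ := exists_scale s t h
  refine ⟨!![(k : ℂ) * s, k * t; - (k * star t), k * star s], ?_, k, rfl, rfl⟩
  rw [Matrix.mem_unitaryGroup_iff]
  simp only [Complex.star_def] at hk
  ext i j
  fin_cases i <;> fin_cases j <;>
    simp [Matrix.mul_apply, Fin.sum_univ_two, Matrix.star_apply] <;> first | ring1 | linear_combination hk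

theorem row1 (s t : ℂ) (h : ¬ (s = 0 ∧ t = 0)) :
    ∃ U ∈ Matrix.unitaryGroup (Fin 2) ℂ, ∃ k : ℂ, U 1 0 = k * s ∧ U 1 1 = k * t := by
  obtain ⟨k, hk⟩ := exists_scale s t h
  refine ⟨!![- (k * star t), k * star s; (k : ℂ) * s, k * t], ?_, k, rfl, rfl⟩
  rw [Matrix.mem_unitaryGroup_iff]
  simp only [Complex.star_def] at hk
  ext i j
  fin_cases i <;> fin_cases j <;>
    simp [Matrix.mul_apply, Fin.sum_univ_two, Matrix.star_apply] <;> first | ring1 | linear_combination hk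

theorem kill (x y : ℂ) :
    ∃ U ∈ Matrix.unitaryGroup (Fin 2) ℂ, U 1 0 * x + U 1 1 * y = 0 := by
  by_cases h : y = 0 ∧ -x = 0
  · refine ⟨1, one_mem _, ?_⟩
    rw [h.1, neg_eq_zero.1 h.2]; simp
  · obtain ⟨U, hU, k, h0, h1⟩ := row1 y (-x) h
    exact ⟨U, hU, by rw [h0, h1]; ring⟩

/-- Diagonal entry can be rotated to the minimal eigenvalue. -/
theorem rot_min {M : M2} (hM : M.IsHermitian) (ht : M.trace = 1) :
    ∃ U ∈ Matrix.unitaryGroup (Fin 2) ℂ, (U * M * Uᴴ) 1 1 = (minEig M : ℂ) := by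
  obtain ⟨-, hd⟩ := minEig_det hM ht
  set p := minEig M
  have hdet : (M - (p : ℂ) • (1 : M2)).det = 0 := by
    rw [Matrix.det_fin_two] at hd ⊢
    rw [Matrix.trace_fin_two] at ht
    simp
    push_cast at hd
    linear_combination hd - (p : ℂ) * ht
  obtain ⟨u, hu, hMu⟩ := Matrix.exists_mulVec_eq_zero_iff.2 hdet
  have e0 := congrFun hMu 0
  have e1 := congrFun hMu 1
  simp [Matrix.mulVec, dotProduct, Fin.sum_univ_two] at e0 e1
  have hne : ¬ (star (u 0) = 0 ∧ star (u 1) = 0) := by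
    rintro ⟨h0, h1⟩
    apply hu
    funext i
    fin_cases i
    · simpa using h0
    · simpa using h1
  obtain ⟨U, hU, k, h0, h1⟩ := row1 _ _ hne
  refine ⟨U, hU, ?_⟩
  have hUU := congrFun (congrFun (Matrix.mem_unitaryGroup_iff.1 hU) 1) 1
  simp [Matrix.mul_apply, Fin.sum_univ_two, Matrix.star_apply, h0, h1] at hUU ⊢
  linear_combination (p : ℂ) * hUU + k * (starRingEnd ℂ) k * (starRingEnd ℂ) (u 0) * e0
    + k * (starRingEnd ℂ) k * (starRingEnd ℂ) (u 1) * e1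

/-- Only the components 000, 101, 110, 111 may be nonzero. -/
def Form (v : H3) : Prop := v (0, 0, 1) = 0 ∧ v (0, 1, 0) = 0 ∧ v (0, 1, 1) = 0 ∧ v (1, 0, 0) = 0

theorem ratio (z z' : ℂ) (h : Complex.normSq z = Complex.normSq z') :
    ∃ u : ℂ, u * star u = 1 ∧ z' = u * z := by
  by_cases hz : z = 0
  · refine ⟨1, by simp, ?_⟩
    rw [hz] at h ⊢
    simpa using h.symm
  · refine ⟨z' / z, ?_, by field_simp⟩
    rw [Complex.star_def, Complex.mul_conj, Complex.normSq_div, ← h, div_self]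
    · simp
    · simpa using hz

theorem diag_unitary {x y : ℂ} (hx : x * star x = 1) (hy : y * star y = 1) :
    !![x, 0; 0, y] ∈ Matrix.unitaryGroup (Fin 2) ℂ := by
  rw [Matrix.mem_unitaryGroup_iff]
  simp only [Complex.star_def] at hx hy
  ext i j
  fin_cases i <;> fin_cases j <;>
    simp [Matrix.mul_apply, Fin.sum_univ_two, Matrix.star_apply, hx, hy]

theorem phase {v w : H3} (fv : Form v) (fw : Form w)
    (h0 : Complex.normSq (v (0, 0, 0)) = Complex.normSq (w (0, 0, 0)))
    (hb : Complex.normSq (v (1, 0, 1)) = Complex.normSq (w (1, 0, 1)))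
    (hc : Complex.normSq (v (1, 1, 0)) = Complex.normSq (w (1, 1, 0)))
    (hd : Complex.normSq (v (1, 1, 1)) = Complex.normSq (w (1, 1, 1))) : LUequiv v w := by
  obtain ⟨l, l1, l2⟩ := ratio _ _ h0
  obtain ⟨b, b1, b2⟩ := ratio _ _ hb
  obtain ⟨c, c1, c2⟩ := ratio _ _ hc
  obtain ⟨d, d1, d2⟩ := ratio _ _ hd
  obtain ⟨v1, v2, v3, v4⟩ := fv
  obtain ⟨w1, w2, w3, w4⟩ := fw
  refine ⟨!![l, 0; 0, b * c * star d], !![1, 0; 0, d * star b], !![1, 0; 0, d * star c],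
    diag_unitary l1 ?_, diag_unitary (by simp) ?_, diag_unitary (by simp) ?_, ?_⟩
  · simp only [star_mul, star_star]
    linear_combination c * star c * d * star d * b1 + d * star d * c1 + d1
  · simp only [star_mul, star_star]
    linear_combination d * star d * b1 + d1
  · simp only [star_mul, star_star]
    linear_combination d * star d * c1 + d1
  · simp only [Complex.star_def] at b1 c1 d1
    have e1 : b * c * (starRingEnd ℂ) d * (d * (starRingEnd ℂ) b) = c := by
      linear_combination c * d * (starRingEnd ℂ) d * b1 + c * d1
    have e2 : b * c * (starRingEnd ℂ) d * (d * (starRingEnd ℂ) c) = b := by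
      linear_combination b * d * (starRingEnd ℂ) d * c1 + b * d1
    funext x
    revert x
    simp [Prod.forall, Fin.forall_fin_two, tensor3, v1, v2, v3, v4, w1, w2, w3, w4, l2, b2, c2, d2,
      e1, e2]
    left
    linear_combination (-d) * c1

theorem form_norm {v : H3} (f : Form v) : normSq3 v = Complex.normSq (v (0, 0, 0)) +
    Complex.normSq (v (1, 0, 1)) + Complex.normSq (v (1, 1, 0)) + Complex.normSq (v (1, 1, 1)) := by
  obtain ⟨v1, v2, v3, v4⟩ := f
  simp [normSq3, Fintype.sum_prod_type, Fin.sum_univ_two, v1, v2, v3, v4]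
  ring

theorem form_det2 {v : H3} (f : Form v) : (rho2 v).det =
    (((Complex.normSq (v (0, 0, 0)) + Complex.normSq (v (1, 0, 1))) *
      (Complex.normSq (v (1, 1, 0)) + Complex.normSq (v (1, 1, 1))) -
      Complex.normSq (v (1, 0, 1)) * Complex.normSq (v (1, 1, 1)) : ℝ) : ℂ) := by
  obtain ⟨v1, v2, v3, v4⟩ := f
  simp [rho2, Matrix.det_fin_two, Fin.sum_univ_two, v1, v2, v3, v4,
    Complex.normSq_eq_conj_mul_self]
  ring

theorem form_det3 {v : H3} (f : Form v) : (rho3 v).det =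
    (((Complex.normSq (v (0, 0, 0)) + Complex.normSq (v (1, 1, 0))) *
      (Complex.normSq (v (1, 0, 1)) + Complex.normSq (v (1, 1, 1))) -
      Complex.normSq (v (1, 1, 0)) * Complex.normSq (v (1, 1, 1)) : ℝ) : ℂ) := by
  obtain ⟨v1, v2, v3, v4⟩ := f
  simp [rho3, Matrix.det_fin_two, Fin.sum_univ_two, v1, v2, v3, v4,
    Complex.normSq_eq_conj_mul_self]
  ring

/-- Real data of a Hermitian trace-one matrix. -/
theorem herm_det {M : M2} (hM : M.IsHermitian) (ht : M.trace = 1) :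
    ∃ x : ℝ, M 0 0 = x ∧ M.det = ((x * (1 - x) - Complex.normSq (M 0 1) : ℝ) : ℂ) := by
  have h00 : (starRingEnd ℂ) (M 0 0) = M 0 0 := hM.apply 0 0
  have h10 : (starRingEnd ℂ) (M 0 1) = M 1 0 := hM.apply 1 0
  obtain ⟨x, hx⟩ := Complex.conj_eq_iff_real.1 h00
  refine ⟨x, hx, ?_⟩
  rw [Matrix.trace_fin_two, hx] at ht
  rw [Matrix.det_fin_two, hx]
  push_cast
  rw [Complex.normSq_eq_conj_mul_self, h10]
  linear_combination (x : ℂ) * ht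

theorem quad (a0 a1 a2 a3 b0 b1 b2 b3 : ℂ) : ∃ s t : ℂ, ¬ (s = 0 ∧ t = 0) ∧
    (s * a0 + t * b0) * (s * a3 + t * b3) - (s * a1 + t * b1) * (s * a2 + t * b2) = 0 := by
  by_cases h : b0 * b3 - b1 * b2 = 0
  · exact ⟨0, 1, by simp, by linear_combination h⟩
  · obtain ⟨r, hr⟩ := IsAlgClosed.exists_pow_nat_eq
      (discrim (b0 * b3 - b1 * b2) (a0 * b3 + a3 * b0 - a1 * b2 - a2 * b1) (a0 * a3 - a1 * a2))
      (n := 2) (by norm_num)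
    obtain ⟨t, ht⟩ := exists_quadratic_eq_zero h ⟨r, by rw [← hr]; ring⟩
    exact ⟨1, t, by simp, by linear_combination ht⟩

theorem null_row (a0 a1 a2 a3 : ℂ) (h : a0 * a3 - a1 * a2 = 0) : ∃ s t : ℂ, ¬ (s = 0 ∧ t = 0) ∧
    s * a0 + t * a2 = 0 ∧ s * a1 + t * a3 = 0 := by
  by_cases h0 : a2 = 0 ∧ -a0 = 0
  · obtain ⟨h2, h0⟩ := h0
    rw [neg_eq_zero] at h0
    by_cases h1 : a3 = 0 ∧ -a1 = 0
    · obtain ⟨h3, h1⟩ := h1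
      rw [neg_eq_zero] at h1
      exact ⟨1, 0, by simp, by simp [h0], by simp [h1]⟩
    · exact ⟨a3, -a1, h1, by rw [h0, h2]; ring, by ring⟩
  · exact ⟨a2, -a0, h0, by ring, by linear_combination -h⟩

theorem half_form {v : H3} (hv : normSq3 v = 1) (hd : (rho1 v).det = ((1 / 4 : ℝ) : ℂ)) :
    ∃ w, LUequiv v w ∧ Form w ∧ Complex.normSq (w (0, 0, 0)) = 1 / 2 := by
  obtain ⟨s, t, hst, hq⟩ := quad (v (0, 0, 0)) (v (0, 0, 1)) (v (0, 1, 0)) (v (0, 1, 1))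
    (v (1, 0, 0)) (v (1, 0, 1)) (v (1, 1, 0)) (v (1, 1, 1))
  obtain ⟨U1, hU1, k, k0, k1⟩ := row0 s t hst
  set v1 := tensor3 U1 1 1 v with hv1
  have hdet : v1 (0, 0, 0) * v1 (0, 1, 1) - v1 (0, 0, 1) * v1 (0, 1, 0) = 0 := by
    simp only [hv1, act1, k0, k1]
    linear_combination k ^ 2 * hq
  obtain ⟨s', t', hst', n0, n1⟩ := null_row _ _ _ _ hdet
  obtain ⟨U2, hU2, k', k0', k1'⟩ := row1 s' t' hst'
  set v2 := tensor3 1 U2 1 v1 with hv2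
  have z0 : v2 (0, 1, 0) = 0 := by
    simp only [hv2, act2, k0', k1']; linear_combination k' * n0
  have z1 : v2 (0, 1, 1) = 0 := by
    simp only [hv2, act2, k0', k1']; linear_combination k' * n1
  obtain ⟨U3, hU3, hk⟩ := kill (v2 (0, 0, 0)) (v2 (0, 0, 1))
  set v3 := tensor3 1 1 U3 v2 with hv3
  have y0 : v3 (0, 1, 0) = 0 := by simp only [hv3, act3, z0, z1]; ring
  have y1 : v3 (0, 1, 1) = 0 := by simp only [hv3, act3, z0, z1]; ring
  have y2 : v3 (0, 0, 1) = 0 := by simp only [hv3, act3, hk]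
  have hLU : LUequiv v v3 := LU_trans (LU1 hU1 v) (LU_trans (LU2 hU2 v1) (LU3 hU3 v2))
  obtain ⟨i0, i1, -, -⟩ := LU_inv hLU
  rw [hv] at i0
  rw [hd] at i1
  obtain ⟨x, hx, hxd⟩ := herm_det (herm1 v3) (trace1 i0)
  rw [i1] at hxd
  have hxd' : (1 / 4 : ℝ) = x * (1 - x) - Complex.normSq (rho1 v3 0 1) := by exact_mod_cast hxd
  have hnn := Complex.normSq_nonneg (rho1 v3 0 1)
  have hx2 : x = 1 / 2 := by nlinarith [sq_nonneg (x - 1 / 2)]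
  have hn : Complex.normSq (rho1 v3 0 1) = 0 := by rw [hx2] at hxd'; linarith
  rw [Complex.normSq_eq_zero] at hn
  have hl : Complex.normSq (v3 (0, 0, 0)) = 1 / 2 := by
    rw [hx2] at hx
    simp [rho1, Fin.sum_univ_two, y0, y1, y2, Complex.mul_conj] at hx
    have : ((Complex.normSq (v3 (0, 0, 0)) : ℝ) : ℂ) = ((1 / 2 : ℝ) : ℂ) := by
      rw [hx]; norm_num
    exact_mod_cast this
  refine ⟨v3, hLU, ⟨y2, y0, y1, ?_⟩, hl⟩
  simp [rho1, Fin.sum_univ_two, y0, y1, y2] at hn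
  rcases hn with h | h
  · rw [h] at hl; norm_num at hl
  · exact h

theorem half_case {v w : H3} (hv : normSq3 v = 1) (hw : normSq3 w = 1)
    (hd : (rho1 v).det = ((1 / 4 : ℝ) : ℂ)) (d1 : (rho1 w).det = (rho1 v).det)
    (d2 : (rho2 w).det = (rho2 v).det) (d3 : (rho3 w).det = (rho3 v).det) : LUequiv v w := by
  obtain ⟨v', lv, fv, nv⟩ := half_form hv hd
  obtain ⟨w', lw, fw, nw⟩ := half_form hw (d1.trans hd)
  obtain ⟨iv0, -, iv2, iv3⟩ := LU_inv lv
  obtain ⟨iw0, -, iw2, iw3⟩ := LU_inv lw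
  have e2 : (rho2 w').det = (rho2 v').det := by rw [iw2, iv2, d2]
  have e3 : (rho3 w').det = (rho3 v').det := by rw [iw3, iv3, d3]
  rw [form_det2 fv, form_det2 fw] at e2
  rw [form_det3 fv, form_det3 fw] at e3
  rw [hv, form_norm fv] at iv0
  rw [hw, form_norm fw] at iw0
  rw [Complex.ofReal_inj] at e2 e3
  have pv := Complex.normSq_nonneg (v' (1, 1, 1))
  have pw := Complex.normSq_nonneg (w' (1, 1, 1))
  have key : ∀ B C D B' C' D' : ℝ, 0 ≤ D → 0 ≤ D' → 1 / 2 + B + C + D = 1 →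
      1 / 2 + B' + C' + D' = 1 → (1 / 2 + B') * (C' + D') - B' * D' = (1 / 2 + B) * (C + D) - B * D →
      (1 / 2 + C') * (B' + D') - C' * D' = (1 / 2 + C) * (B + D) - C * D →
      B = B' ∧ C = C' ∧ D = D' := by
    intro B C D B' C' D' hD hD' h h' h2 h3
    have eD : D = 1 / 2 - B - C := by linarith
    have eD' : D' = 1 / 2 - B' - C' := by linarith
    subst eD
    subst eD'
    have hdiff : C' = B' + (C - B) := by linarith
    subst hdiff
    have hprod : (B - B') * (B' + C - 1 / 2) = 0 := by linear_combination -h2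
    rcases mul_eq_zero.1 hprod with h0 | h0
    · exact ⟨by linarith, by linarith, by linarith⟩
    · exact ⟨by linarith, by linarith, by linarith⟩
  rw [nv] at iv0 e2 e3
  rw [nw] at iw0 e2 e3
  obtain ⟨kb, kc, kd⟩ := key _ _ _ _ _ _ pv pw iv0 iw0 e2 e3
  exact LU_trans lv (LU_trans (phase fv fw (by rw [nv, nw]) kb kc kd) (LU_symm lw))

theorem sum_form {v : H3} (hv : normSq3 v = 1) (hp : p1 v = p2 v + p3 v) :
    ∃ w, LUequiv v w ∧ Form w ∧ Complex.normSq (w (1, 1, 1)) = 0 ∧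
      Complex.normSq (w (1, 1, 0)) = p2 v ∧ Complex.normSq (w (1, 0, 1)) = p3 v := by
  obtain ⟨U2, hU2, hm2⟩ := rot_min (herm2 v) (trace2 hv)
  obtain ⟨U3, hU3, hm3⟩ := rot_min (herm3 v) (trace3 hv)
  obtain ⟨U1, hU1, hk⟩ := kill (tensor3 1 U2 U3 v (0, 0, 0)) (tensor3 1 U2 U3 v (1, 0, 0))
  set w := tensor3 U1 U2 U3 v with hwdef
  have hLU : LUequiv v w := ⟨U1, U2, U3, hU1, hU2, hU3, rfl⟩
  have hw' : w = tensor3 U1 1 1 (tensor3 1 U2 U3 v) := by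
    rw [tensor3_comp]; simp [hwdef]
  have w100 : w (1, 0, 0) = 0 := by rw [hw', act1, hk]
  rw [← rho2_tensor hU1 hU3, ← hwdef] at hm2
  rw [← rho3_tensor hU1 hU2, ← hwdef] at hm3
  change _ = ((p2 v : ℝ) : ℂ) at hm2
  change _ = ((p3 v : ℝ) : ℂ) at hm3
  obtain ⟨i0, i1, -, -⟩ := LU_inv hLU
  rw [hv] at i0
  obtain ⟨hple, hpd⟩ := minEig_det (herm1 v) (trace1 hv)
  change p1 v ≤ 1 / 2 at hple
  change _ = (((p1 v) * (1 - p1 v) : ℝ) : ℂ) at hpd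
  obtain ⟨x, hx, hxd⟩ := herm_det (herm1 w) (trace1 i0)
  rw [i1, hpd, Complex.ofReal_inj] at hxd
  have hnn := Complex.normSq_nonneg (rho1 w 0 1)
  have hxle : x ≤ 1 - p1 v := by
    by_contra hc
    push Not at hc
    nlinarith
  have m2 : Complex.normSq (w (0, 1, 0)) + Complex.normSq (w (0, 1, 1)) +
      (Complex.normSq (w (1, 1, 0)) + Complex.normSq (w (1, 1, 1))) = p2 v := by
    simp [rho2, Fin.sum_univ_two, Complex.mul_conj] at hm2
    exact_mod_cast hm2
  have m3 : Complex.normSq (w (0, 0, 1)) + Complex.normSq (w (0, 1, 1)) +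
      (Complex.normSq (w (1, 0, 1)) + Complex.normSq (w (1, 1, 1))) = p3 v := by
    simp [rho3, Fin.sum_univ_two, Complex.mul_conj] at hm3
    exact_mod_cast hm3
  have m1 : Complex.normSq (w (0, 0, 0)) + Complex.normSq (w (0, 0, 1)) +
      (Complex.normSq (w (0, 1, 0)) + Complex.normSq (w (0, 1, 1))) = x := by
    simp [rho1, Fin.sum_univ_two, Complex.mul_conj] at hx
    exact_mod_cast hx
  simp [normSq3, Fintype.sum_prod_type, Fin.sum_univ_two, w100] at i0
  have q1 := Complex.normSq_nonneg (w (0, 0, 1))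
  have q2 := Complex.normSq_nonneg (w (0, 1, 0))
  have q3 := Complex.normSq_nonneg (w (0, 1, 1))
  have q4 := Complex.normSq_nonneg (w (1, 1, 1))
  have r1 : Complex.normSq (w (0, 0, 1)) = 0 := by linarith
  have r2 : Complex.normSq (w (0, 1, 0)) = 0 := by linarith
  have r3 : Complex.normSq (w (0, 1, 1)) = 0 := by linarith
  have r4 : Complex.normSq (w (1, 1, 1)) = 0 := by linarith
  exact ⟨w, hLU, ⟨Complex.normSq_eq_zero.1 r1, Complex.normSq_eq_zero.1 r2,
    Complex.normSq_eq_zero.1 r3, w100⟩, r4, by linarith, by linarith⟩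

theorem sum_case {v w : H3} (hv : normSq3 v = 1) (hw : normSq3 w = 1)
    (hp : p1 v = p2 v + p3 v) (h1 : p1 w = p1 v) (h2 : p2 w = p2 v) (h3 : p3 w = p3 v) :
    LUequiv v w := by
  obtain ⟨v', lv, fv, dv, cv, bv⟩ := sum_form hv hp
  obtain ⟨w', lw, fw, dw, cw, bw⟩ := sum_form hw (by rw [h1, h2, h3, hp])
  obtain ⟨iv0, -⟩ := LU_inv lv
  obtain ⟨iw0, -⟩ := LU_inv lw
  rw [hv, form_norm fv] at iv0
  rw [hw, form_norm fw] at iw0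
  exact LU_trans lv (LU_trans (phase fv fw (by linarith) (by rw [bv, bw, h3])
    (by rw [cv, cw, h2]) (by rw [dv, dw])) (LU_symm lw))

/-- Both kinds of faces, attached to the first qubit. -/
theorem first_case {v w : H3} (hv : normSq3 v = 1) (hw : normSq3 w = 1)
    (hp : p1 v = 1 / 2 ∨ p1 v = p2 v + p3 v)
    (h1 : p1 w = p1 v) (h2 : p2 w = p2 v) (h3 : p3 w = p3 v) : LUequiv v w := by
  rcases hp with hp | hp
  · have a1 := (minEig_det (herm1 v) (trace1 hv)).2
    have a2 := (minEig_det (herm2 v) (trace2 hv)).2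
    have a3 := (minEig_det (herm3 v) (trace3 hv)).2
    have b1 := (minEig_det (herm1 w) (trace1 hw)).2
    have b2 := (minEig_det (herm2 w) (trace2 hw)).2
    have b3 := (minEig_det (herm3 w) (trace3 hw)).2
    unfold p1 at h1 hp
    unfold p2 at h2
    unfold p3 at h3
    refine half_case hv hw ?_ ?_ ?_ ?_
    · rw [a1, hp]; norm_num
    · rw [a1, b1, h1]
    · rw [a2, b2, h2]
    · rw [a3, b3, h3]
  · exact sum_case hv hw hp h1 h2 h3

/-- a pure three-qubit state whose local minimal eigenvalues lie on the
boundary of the Kirwan polytope is determined up to local unitaries by its local spectra. -/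
theorem boundary_of_Kirwan_polytope_determined_up_to_LU
    (v : H3) (hv : normSq3 v = 1)
    (hbdry : p1 v = 1 / 2 ∨ p2 v = 1 / 2 ∨ p3 v = 1 / 2 ∨
      p1 v = p2 v + p3 v ∨ p2 v = p1 v + p3 v ∨ p3 v = p1 v + p2 v)
    (w : H3) (hw : normSq3 w = 1)
    (h1 : p1 w = p1 v) (h2 : p2 w = p2 v) (h3 : p3 w = p3 v) :
    LUequiv v w := by
  have s121 : ∀ u, p1 (sw12 u) = p2 u := fun u => by rw [p1, p2, rho1_sw12]
  have s122 : ∀ u, p2 (sw12 u) = p1 u := fun u => by rw [p1, p2, rho2_sw12]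
  have s123 : ∀ u, p3 (sw12 u) = p3 u := fun u => by rw [p3, p3, rho3_sw12]
  have s131 : ∀ u, p1 (sw13 u) = p3 u := fun u => by rw [p1, p3, rho1_sw13]
  have s132 : ∀ u, p2 (sw13 u) = p2 u := fun u => by rw [p2, p2, rho2_sw13]
  have s133 : ∀ u, p3 (sw13 u) = p1 u := fun u => by rw [p1, p3, rho3_sw13]
  have c1 := fun hp => first_case hv hw hp h1 h2 h3
  have c2 := fun hp => LU_sw12 (first_case (v := sw12 v) (w := sw12 w)
    (by rw [normSq3_sw12, hv]) (by rw [normSq3_sw12, hw]) hp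
    (by rw [s121, s121, h2]) (by rw [s122, s122, h1]) (by rw [s123, s123, h3]))
  have c3 := fun hp => LU_sw13 (first_case (v := sw13 v) (w := sw13 w)
    (by rw [normSq3_sw13, hv]) (by rw [normSq3_sw13, hw]) hp
    (by rw [s131, s131, h3]) (by rw [s132, s132, h2]) (by rw [s133, s133, h1]))
  rw [s121, s122, s123] at c2
  rw [s131, s132, s133] at c3
  rcases hbdry with h | h | h | h | h | h
  · exact c1 (Or.inl h)
  · exact c2 (Or.inl h)
  · exact c3 (Or.inl h)
  · exact c1 (Or.inr h)
  · exact c2 (Or.inr h)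
  · exact c3 (Or.inr (by rw [h, add_comm]))
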